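/- Let N ≥ 2 be an even integer, k = N/2, and let f : [0,1) → [0,∞) be continuous with f(0) = 0 and f(r) > 0 for r ∈ (0,1), satisfying limsup_{r→0⁺} f(r)·|ln r|^σ < ∞ for some σ > 2. Let MT_N(f) = sup { ∫₀¹ r^{N−1} exp(μ_N |v(r)|^{(N+2)/N + f(r)}) dr : v ∈ X_1, ‖v‖_{X_1} = 1 }. Suppose (v_j) ⊂ X_1 is a maximizing sequence for MT_N(f) with ‖v_j‖_{X_1} = 1, v_j ⇀ 0 weakly in X_1 (meaning ∫₀¹ r^{N−k} |v_j'(r)|^{k−1} v_j'(r) g(r) dr → 0 for every measurable g with ∫₀¹ r^{N−k}|g(r)|^{(k+1)/k} dr < ∞), v_j(r) → 0 for a.e. r ∈ (0,1), and suppose (v_j) is NOT a normalized concentrating sequence at the origin, i.e., there exists r₀ ∈ (0,1) such that liminf_{j→∞} ∫_{r₀}¹ r^{N−k}|v_j'(r)|^{k+1} dr > 0. Then MT_N(f) = 1/N. -/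

import Mathlib

open MeasureTheory Real Set Filter
open scoped ENNReal

/-- Surface area of the unit sphere in `ℝ^N` (equals `N` times the volume of the unit ball). -/
noncomputable def omegaS (N : ℕ) : ℝ :=
  N * (volume (Metric.ball (0 : EuclideanSpace ℝ (Fin N)) 1)).toReal

/-- The normalising constant `c_N = ω_{N-1} · binom(N,k) / N`. -/
noncomputable def cN (N k : ℕ) : ℝ := omegaS N * (N.choose k) / N

/-- The critical constant `μ_N = N · (ω_{N-1} · binom(N-1,k-1) / k)^{2/N}`. -/
noncomputable def muN (N k : ℕ) : ℝ :=
  N * (omegaS N * ((N - 1).choose (k - 1)) / k) ^ ((2 : ℝ) / N)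

/-- Membership in the weighted space `X₁`: `v` is locally absolutely continuous on `(0,1)`
with derivative `v'` (in the sense of the fundamental theorem of calculus),
`v(r) → 0` as `r → 1⁻`, and the two defining weighted integrals are finite. -/
structure MemX1 (N k : ℕ) (v v' : ℝ → ℝ) : Prop where
  locAC : ∀ a ∈ Ioo (0:ℝ) 1, ∀ b ∈ Ioo (0:ℝ) 1,
    IntervalIntegrable v' volume a b ∧ v b - v a = ∫ t in a..b, v' t
  lim_one : Tendsto v (nhdsWithin 1 (Iio 1)) (nhds 0)
  grad_int : ∫⁻ r in Ioo (0:ℝ) 1, ENNReal.ofReal (r ^ (N - k) * |v' r| ^ (k + 1)) < ⊤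
  fun_int : ∫⁻ r in Ioo (0:ℝ) 1, ENNReal.ofReal (r ^ (N - 1) * |v r| ^ (k + 1)) < ⊤

/-- The norm on `X₁`: `‖v‖ = (c_N ∫₀¹ r^{N-k} |v'|^{k+1} dr)^{1/(k+1)}`. -/
noncomputable def normX1 (N k : ℕ) (v' : ℝ → ℝ) : ℝ :=
  (cN N k * ∫ r in Ioo (0:ℝ) 1, r ^ (N - k) * |v' r| ^ (k + 1)) ^ (1 / (k + 1 : ℝ))

/-- The supercritical Trudinger–Moser integral `∫₀¹ r^{N-1} exp(β |v|^{(N+2)/N + f(r)}) dr`. -/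
noncomputable def mtIntegral (N : ℕ) (β : ℝ) (f v : ℝ → ℝ) : ℝ≥0∞ :=
  ∫⁻ r in Ioo (0:ℝ) 1,
    ENNReal.ofReal (r ^ (N - 1) * exp (β * |v r| ^ (((N : ℝ) + 2) / N + f r)))

/-- Weak convergence in `X₁` of the (nonlinear gradients of the) sequence `vj'` to `w'`:
tested against all `g` with `∫₀¹ r^{N-k} |g|^{(k+1)/k} dr < ∞`. -/
def WeakConvX1 (N k : ℕ) (vj' : ℕ → ℝ → ℝ) (w' : ℝ → ℝ) : Prop :=
  ∀ g : ℝ → ℝ, Measurable g →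
    (∫⁻ r in Ioo (0:ℝ) 1, ENNReal.ofReal (r ^ (N - k) * |g r| ^ ((k + 1 : ℝ) / k)) < ⊤) →
    Tendsto (fun j => ∫ r in Ioo (0:ℝ) 1, r ^ (N - k) * |vj' j r| ^ (k - 1) * vj' j r * g r)
      atTop (nhds (∫ r in Ioo (0:ℝ) 1, r ^ (N - k) * |w' r| ^ (k - 1) * w' r * g r))

theorem omegaS_pos {N : ℕ} (hN : 0 < N) : 0 < omegaS N := by
  have : (0:ℝ) < N := by exact_mod_cast hN
  refine mul_pos this (ENNReal.toReal_pos ?_ measure_ball_lt_top.ne)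
  exact (Metric.measure_ball_pos volume _ one_pos).ne'

theorem cN_pos {N k : ℕ} (hN : 0 < N) (hkN : k ≤ N) : 0 < cN N k := by
  have h1 : (0:ℝ) < N := by exact_mod_cast hN
  have h2 : (0:ℝ) < N.choose k := by exact_mod_cast Nat.choose_pos hkN
  exact div_pos (mul_pos (omegaS_pos hN) h2) h1

theorem muN_eq {N k : ℕ} (hk : 0 < k) (hN : 0 < N) :
    muN N k = N * cN N k ^ ((2 : ℝ) / N) := by
  obtain ⟨m, rfl⟩ : ∃ m, k = m + 1 := ⟨k - 1, by omega⟩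
  obtain ⟨n, rfl⟩ : ∃ n, N = n + 1 := ⟨N - 1, by omega⟩
  have h : ((n + 1 : ℕ) : ℝ) * (n.choose m) = ((n + 1).choose (m + 1)) * ((m + 1 : ℕ) : ℝ) := by
    exact_mod_cast Nat.add_one_mul_choose_eq n m
  have h1 : ((n + 1 : ℕ) : ℝ) ≠ 0 := by positivity
  have h2 : ((m + 1 : ℕ) : ℝ) ≠ 0 := by positivity
  have : omegaS (n + 1) * (n.choose m) / ((m + 1 : ℕ) : ℝ) = cN (n + 1) (m + 1) := by
    rw [cN, div_eq_div_iff h2 h1]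
    linear_combination omegaS (n + 1) * h
  rw [muN, Nat.add_sub_cancel, Nat.add_sub_cancel, this]

/-- Weighted Hölder estimate for the oscillation of a primitive. -/
theorem abs_integral_le_weighted {k : ℕ} (hk : 0 < k) {a b : ℝ} (ha : 0 < a) (hab : a ≤ b)
    {g : ℝ → ℝ} (hg : IntervalIntegrable g volume a b)
    (hG : IntegrableOn (fun r => r ^ k * |g r| ^ (k + 1)) (Ioc a b)) :
    |∫ t in a..b, g t| ≤
      (∫ r in Ioc a b, r ^ k * |g r| ^ (k + 1)) ^ (1 / (k + 1 : ℝ)) *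
        (log (b / a)) ^ ((k : ℝ) / (k + 1)) := by
  have hk' : (0:ℝ) < k := by exact_mod_cast hk
  have hpq : ((k + 1 : ℝ)).HolderConjugate ((k + 1 : ℝ) / k) := by
    rw [Real.holderConjugate_iff]
    refine ⟨by linarith, ?_⟩
    field_simp
    ring
  have hgm : AEStronglyMeasurable g (volume.restrict (Ioc a b)) := by
    have := hg.1.aestronglyMeasurable
    simpa using this
  have hpos : ∀ r ∈ Ioc a b, 0 < r := fun r hr => ha.trans hr.1
  set F : ℝ → ℝ := fun r => r ^ ((k : ℝ) / (k + 1)) * |g r| with hF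
  set W : ℝ → ℝ := fun r => r ^ (-((k : ℝ) / (k + 1))) with hW
  have hFp : ∀ r ∈ Ioc a b, F r ^ (k + 1 : ℝ) = r ^ k * |g r| ^ (k + 1) := by
    intro r hr
    have h0 := hpos r hr
    have e : (k + 1 : ℝ) = ((k + 1 : ℕ) : ℝ) := by push_cast; ring
    simp only [hF]
    rw [mul_rpow (by positivity) (abs_nonneg _), ← rpow_mul h0.le,
      div_mul_cancel₀ _ (by positivity), rpow_natCast, e, rpow_natCast]
  have hWq : ∀ r ∈ Ioc a b, W r ^ ((k + 1 : ℝ) / k) = r⁻¹ := by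
    intro r hr
    have h0 := hpos r hr
    simp only [hW]
    rw [← rpow_mul h0.le, ← rpow_neg_one]
    congr 1
    field_simp
  have hF0 : ∀ r ∈ Ioc a b, 0 ≤ F r := fun r hr => by
    have h0 := hpos r hr
    simp only [hF]; positivity
  have hW0 : ∀ r ∈ Ioc a b, 0 ≤ W r := fun r hr => by
    have h0 := hpos r hr
    simp only [hW]; positivity
  have hinv : IntegrableOn (fun r : ℝ => r⁻¹) (Ioc a b) := by
    have : IntervalIntegrable (fun r : ℝ => r⁻¹) volume a b := by
      refine (ContinuousOn.intervalIntegrable ?_)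
      intro x hx
      rw [uIcc_of_le hab] at hx
      exact (continuousAt_inv₀ (ha.trans_le hx.1).ne').continuousWithinAt
    simpa using this.1
  have hFm : AEStronglyMeasurable F (volume.restrict (Ioc a b)) :=
    ((measurable_id.pow_const _).aestronglyMeasurable).mul
      (continuous_abs.comp_aestronglyMeasurable hgm)
  have hWm : AEStronglyMeasurable W (volume.restrict (Ioc a b)) :=
    (measurable_id.pow_const _).aestronglyMeasurable
  have hFL : MemLp F (ENNReal.ofReal (k + 1)) (volume.restrict (Ioc a b)) := by
    rw [← integrable_norm_rpow_iff hFm (by simp; positivity) ENNReal.ofReal_ne_top,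
      ENNReal.toReal_ofReal (by positivity)]
    refine (integrableOn_congr_fun (fun r hr => ?_) measurableSet_Ioc).2 hG
    rw [Real.norm_of_nonneg (hF0 r hr), hFp r hr]
  have hWL : MemLp W (ENNReal.ofReal ((k + 1) / k)) (volume.restrict (Ioc a b)) := by
    rw [← integrable_norm_rpow_iff hWm (by simp; positivity) ENNReal.ofReal_ne_top,
      ENNReal.toReal_ofReal (by positivity)]
    refine (integrableOn_congr_fun (fun r hr => ?_) measurableSet_Ioc).2 hinv
    rw [Real.norm_of_nonneg (hW0 r hr), hWq r hr]
  have key := integral_mul_le_Lp_mul_Lq_of_nonneg hpq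
    ((ae_restrict_iff' measurableSet_Ioc).2 (ae_of_all _ hF0))
    ((ae_restrict_iff' measurableSet_Ioc).2 (ae_of_all _ hW0)) hFL hWL
  rw [setIntegral_congr_fun measurableSet_Ioc hFp, setIntegral_congr_fun measurableSet_Ioc hWq]
    at key
  have e1 : ∫ r in Ioc a b, F r * W r = ∫ r in Ioc a b, |g r| := by
    refine setIntegral_congr_fun measurableSet_Ioc fun r hr => ?_
    have h0 := hpos r hr
    simp only [hF, hW]
    rw [mul_right_comm, ← rpow_add h0]
    simp
  have e2 : ∫ r in Ioc a b, r⁻¹ = log (b / a) := by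
    rw [← intervalIntegral.integral_of_le hab, integral_inv_of_pos ha (ha.trans_le hab)]
  rw [e1, e2, one_div_div] at key
  refine le_trans ?_ key
  rw [intervalIntegral.integral_of_le hab]
  exact abs_integral_le_integral_abs

theorem MemX1.continuousOn {N k : ℕ} {v v' : ℝ → ℝ} (h : MemX1 N k v v') :
    ContinuousOn v (Ioo 0 1) := by
  intro x hx
  refine ContinuousAt.continuousWithinAt ?_
  obtain ⟨a, ha0, hax⟩ := exists_between hx.1
  obtain ⟨b, hxb, hb1⟩ := exists_between hx.2
  have ha : a ∈ Ioo (0:ℝ) 1 := ⟨ha0, hax.trans hx.2⟩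
  have hb : b ∈ Ioo (0:ℝ) 1 := ⟨hx.1.trans hxb, hb1⟩
  have hI : IntegrableOn v' (uIcc a b) := by
    rw [uIcc_of_le (hax.trans hxb).le, integrableOn_Icc_iff_integrableOn_Ioc]
    exact (h.locAC a ha b hb).1.1
  have hc := intervalIntegral.continuousOn_primitive_interval hI
  rw [uIcc_of_le (hax.trans hxb).le] at hc
  have hc' : ContinuousOn v (Icc a b) := by
    refine (hc.const_add (v a)).congr fun y hy => ?_
    have := (h.locAC a ha y ⟨ha0.trans_le hy.1, hy.2.trans_lt hb1⟩).2
    linarith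
  exact hc'.continuousAt (Icc_mem_nhds hax hxb)

/-- The radial majorant of the unit ball of `X₁` with exponent `k` and constant `c`. -/
noncomputable def radialBound (k : ℕ) (c r : ℝ) : ℝ :=
  (1 / c) ^ (1 / (k + 1 : ℝ)) * (-log r) ^ ((k : ℝ) / (k + 1))

theorem integrableOn_of_normX1_eq_one {N k : ℕ} {v' : ℝ → ℝ} (hn : normX1 N k v' = 1)
    (hc : 0 < cN N k) :
    IntegrableOn (fun r => r ^ (N - k) * |v' r| ^ (k + 1)) (Ioo 0 1) ∧
      ∫ r in Ioo (0:ℝ) 1, r ^ (N - k) * |v' r| ^ (k + 1) = 1 / cN N k := by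
  have hI : 0 ≤ ∫ r in Ioo (0:ℝ) 1, r ^ (N - k) * |v' r| ^ (k + 1) :=
    setIntegral_nonneg measurableSet_Ioo fun r hr => by
      have := hr.1
      positivity
  have h1 : cN N k * ∫ r in Ioo (0:ℝ) 1, r ^ (N - k) * |v' r| ^ (k + 1) = 1 := by
    rw [normX1] at hn
    exact (rpow_left_inj (by positivity) zero_le_one (by positivity)).1 (hn.trans (one_rpow _).symm)
  refine ⟨?_, ?_⟩
  · by_contra hni
    rw [integral_undef hni, mul_zero] at h1
    exact zero_ne_one h1
  · field_simp
    linarith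

section Estimates

variable {N k : ℕ} {v v' : ℝ → ℝ}

theorem MemX1.abs_sub_le (hk : 0 < k) (hN : N = 2 * k) (h : MemX1 N k v v')
    (hG : IntegrableOn (fun r => r ^ (N - k) * |v' r| ^ (k + 1)) (Ioo 0 1))
    {a b E : ℝ} (ha : 0 < a) (hab : a ≤ b) (hb : b < 1)
    (hE : ∫ r in Ioc a b, r ^ (N - k) * |v' r| ^ (k + 1) ≤ E) :
    |v b - v a| ≤ E ^ (1 / (k + 1 : ℝ)) * (-log a) ^ ((k : ℝ) / (k + 1)) := by
  have e : N - k = k := by omega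
  rw [e] at hG hE
  have ha' : a ∈ Ioo (0:ℝ) 1 := ⟨ha, hab.trans_lt hb⟩
  have hb' : b ∈ Ioo (0:ℝ) 1 := ⟨ha.trans_le hab, hb⟩
  have hsub : Ioc a b ⊆ Ioo 0 1 := fun x hx => ⟨ha.trans hx.1, hx.2.trans_lt hb⟩
  have hI : 0 ≤ ∫ r in Ioc a b, r ^ k * |v' r| ^ (k + 1) :=
    setIntegral_nonneg measurableSet_Ioc fun r hr => by
      have := (hsub hr).1
      positivity
  rw [(h.locAC a ha' b hb').2]
  refine (abs_integral_le_weighted hk ha hab (h.locAC a ha' b hb').1 (hG.mono_set hsub)).trans ?_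
  have hlog : 0 ≤ log (b / a) := log_nonneg ((one_le_div ha).2 hab)
  have hlog' : log (b / a) ≤ -log a := by
    rw [log_div hb'.1.ne' ha.ne']
    have := log_neg hb'.1 hb
    linarith
  exact mul_le_mul (rpow_le_rpow hI hE (by positivity))
    (rpow_le_rpow hlog hlog' (by positivity)) (rpow_nonneg hlog _)
    (rpow_nonneg (hI.trans hE) _)

theorem MemX1.abs_le_radialBound (hk : 0 < k) (hN : N = 2 * k) (h : MemX1 N k v v')
    (hn : normX1 N k v' = 1) {r : ℝ} (hr : r ∈ Ioo (0:ℝ) 1) :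
    |v r| ≤ radialBound k (cN N k) r := by
  have hc : 0 < cN N k := cN_pos (by omega) (by omega)
  obtain ⟨hG, hI⟩ := integrableOn_of_normX1_eq_one hn hc
  have hlim : Tendsto (fun b => |v b - v r|) (nhdsWithin 1 (Iio 1)) (nhds |0 - v r|) :=
    (h.lim_one.sub_const _).abs
  rw [zero_sub, abs_neg] at hlim
  refine le_of_tendsto hlim ?_
  filter_upwards [Ioo_mem_nhdsLT hr.2] with b hb
  refine h.abs_sub_le hk hN hG hr.1 hb.1.le hb.2 ?_
  rw [← hI]
  refine setIntegral_mono_set hG ?_ ?_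
  · refine (ae_restrict_iff' measurableSet_Ioo).2 (ae_of_all _ fun x hx => ?_)
    have := hx.1
    simp only [Pi.zero_apply]
    positivity
  · exact (show Ioc r b ⊆ Ioo 0 1 from
      fun x hx => ⟨hr.1.trans hx.1, hx.2.trans_lt hb.2⟩).eventuallyLE

/-- If a fixed part of the energy lives outside `(0, r₀)`, the radial bound improves. -/
theorem MemX1.abs_le_of_outer_energy (hk : 0 < k) (hN : N = 2 * k) (h : MemX1 N k v v')
    (hn : normX1 N k v' = 1) {r₀ δ r : ℝ} (hr₀ : r₀ ∈ Ioo (0:ℝ) 1)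
    (hδ : δ ≤ ∫ s in Ioo r₀ 1, s ^ (N - k) * |v' s| ^ (k + 1)) (hr : 0 < r) (hrr : r ≤ r₀) :
    |v r| ≤ radialBound k (cN N k) r₀ +
      (1 / cN N k - δ) ^ (1 / (k + 1 : ℝ)) * (-log r) ^ ((k : ℝ) / (k + 1)) := by
  have hc : 0 < cN N k := cN_pos (by omega) (by omega)
  obtain ⟨hG, hI⟩ := integrableOn_of_normX1_eq_one hn hc
  have h1 := h.abs_le_radialBound hk hN hn hr₀
  have h2 : |v r₀ - v r| ≤
      (1 / cN N k - δ) ^ (1 / (k + 1 : ℝ)) * (-log r) ^ ((k : ℝ) / (k + 1)) := by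
    refine h.abs_sub_le hk hN hG hr hrr hr₀.2 ?_
    have hs1 : Ioc r r₀ ⊆ Ioo 0 1 := fun x hx => ⟨hr.trans hx.1, hx.2.trans_lt hr₀.2⟩
    have hs2 : Ioo r₀ 1 ⊆ Ioo 0 1 := fun x hx => ⟨hr₀.1.trans hx.1, hx.2⟩
    have hd : Disjoint (Ioc r r₀) (Ioo r₀ 1) :=
      Set.disjoint_left.2 fun x hx hx' => absurd hx.2 (not_le.2 hx'.1)
    have hu := setIntegral_union hd measurableSet_Ioo (hG.mono_set hs1) (hG.mono_set hs2)
    have hle : ∫ s in Ioc r r₀ ∪ Ioo r₀ 1, s ^ (N - k) * |v' s| ^ (k + 1) ≤ 1 / cN N k := by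
      rw [← hI]
      refine setIntegral_mono_set hG ?_ (union_subset hs1 hs2).eventuallyLE
      refine (ae_restrict_iff' measurableSet_Ioo).2 (ae_of_all _ fun x hx => ?_)
      have := hx.1
      simp only [Pi.zero_apply]
      positivity
    linarith
  have h3 : |v r| ≤ |v r₀| + |v r₀ - v r| := by
    have := abs_sub_abs_le_abs_sub (v r) (v r₀)
    rw [abs_sub_comm] at this
    linarith
  linarith

end Estimates

theorem tendsto_neg_log_nhdsGT_zero : Tendsto (fun r => -log r) (nhdsWithin 0 (Ioi 0)) atTop :=
  tendsto_neg_atBot_atTop.comp tendsto_log_nhdsGT_zero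

theorem radialBound_nonneg {k : ℕ} {c r : ℝ} (hc : 0 < c) (hr : r ∈ Ioo (0:ℝ) 1) :
    0 ≤ radialBound k c r := by
  have := log_neg hr.1 hr.2
  have : 0 ≤ -log r := by linarith
  unfold radialBound
  positivity

theorem tendsto_radialBound_atTop {k : ℕ} (hk : 0 < k) {c : ℝ} (hc : 0 < c) :
    Tendsto (radialBound k c) (nhdsWithin 0 (Ioi 0)) atTop := by
  have hk' : (0:ℝ) < k := by exact_mod_cast hk
  exact ((tendsto_rpow_atTop (by positivity)).comp tendsto_neg_log_nhdsGT_zero).const_mul_atTop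
    (by positivity)

theorem continuousOn_radialBound {k : ℕ} {c : ℝ} :
    ContinuousOn (radialBound k c) (Ioc 0 1) := by
  refine continuousOn_const.mul (ContinuousOn.rpow_const ?_ fun _ _ => Or.inr (by positivity))
  exact (continuousOn_log.mono fun x hx => hx.1.ne').neg

theorem tendsto_radialBound_one {k : ℕ} (hk : 0 < k) {c : ℝ} :
    Tendsto (radialBound k c) (nhdsWithin 1 (Iio 1)) (nhds 0) := by
  have hk' : (0:ℝ) < k := by exact_mod_cast hk
  have h0 : radialBound k c 1 = 0 := by
    have : (k : ℝ) / (k + 1) ≠ 0 := by positivity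
    simp [radialBound, zero_rpow this]
  have := continuousOn_radialBound (k := k) (c := c) 1 ⟨one_pos, le_rfl⟩
  rw [ContinuousWithinAt, h0] at this
  refine this.mono_left ?_
  rw [nhdsWithin_le_iff]
  filter_upwards [Ioo_mem_nhdsLT (zero_lt_one (α := ℝ))] with x hx using ⟨hx.1, hx.2.le⟩

theorem muN_mul_radialBound_rpow {N k : ℕ} (hk : 0 < k) (hN : N = 2 * k) {r : ℝ}
    (hr : r ∈ Ioo (0:ℝ) 1) :
    muN N k * radialBound k (cN N k) r ^ (((N : ℝ) + 2) / N) = N * (-log r) := by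
  have hk' : (0:ℝ) < k := by exact_mod_cast hk
  have hc : 0 < cN N k := cN_pos (by omega) (by omega)
  have hL : 0 ≤ -log r := by linarith [log_neg hr.1 hr.2]
  have hN' : (N : ℝ) = 2 * k := by exact_mod_cast hN
  have e1 : 1 / (k + 1 : ℝ) * (((N : ℝ) + 2) / N) = 2 / N := by
    rw [hN']; field_simp
  have e2 : (k : ℝ) / (k + 1 : ℝ) * (((N : ℝ) + 2) / N) = 1 := by
    rw [hN']; field_simp
  rw [muN_eq hk (by omega), radialBound, mul_rpow (by positivity) (by positivity),
    ← rpow_mul (by positivity), ← rpow_mul hL, e1, e2, rpow_one, one_div, inv_rpow hc.le]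
  have : cN N k ^ ((2 : ℝ) / N) ≠ 0 := (rpow_pos_of_pos hc _).ne'
  field_simp

/-- A perturbation of the exponent that decays faster than `|log r|⁻²` is invisible on the
scale of the radial bound. -/
theorem tendsto_radialBound_rpow_one {k : ℕ} (hk : 0 < k) {c : ℝ} (hc : 0 < c) {f : ℝ → ℝ}
    (hfpos : ∀ r ∈ Ioo (0:ℝ) 1, 0 < f r)
    (hσ : ∃ σ : ℝ, 2 < σ ∧ IsBoundedUnder (· ≤ ·) (nhdsWithin (0:ℝ) (Ioi 0))
      (fun r => f r * |log r| ^ σ)) :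
    Tendsto (fun r => radialBound k c r ^ f r) (nhdsWithin 0 (Ioi 0)) (nhds 1) := by
  have hk' : (0:ℝ) < k := by exact_mod_cast hk
  obtain ⟨σ, hσ2, C, hC⟩ := hσ
  rw [eventually_map] at hC
  have hL := tendsto_neg_log_nhdsGT_zero
  have hmem : ∀ᶠ r : ℝ in nhdsWithin 0 (Ioi 0), r ∈ Ioo (0:ℝ) 1 :=
    Ioo_mem_nhdsGT zero_lt_one
  have hfL : ∀ᶠ r in nhdsWithin (0:ℝ) (Ioi 0), f r ≤ C * (-log r) ^ (-2 : ℝ) := by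
    filter_upwards [hC, hmem, hL.eventually_ge_atTop 1] with r h1 h2 h3
    rw [abs_of_nonpos (by linarith)] at h1
    have h4 : (-log r) ^ (2:ℝ) ≤ (-log r) ^ σ := rpow_le_rpow_of_exponent_le h3 hσ2.le
    have h5 : f r * (-log r) ^ (2:ℝ) ≤ C :=
      (mul_le_mul_of_nonneg_left h4 (hfpos r h2).le).trans h1
    have h6 : 0 < (-log r) ^ (2:ℝ) := by positivity
    rw [rpow_neg (by linarith), ← div_eq_mul_inv, le_div_iff₀ h6]
    exact h5
  have hlog : Tendsto (fun r => C * (-log r) ^ (-2 : ℝ) * (-log r)) (nhdsWithin 0 (Ioi 0))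
      (nhds 0) := by
    have h1 : Tendsto (fun x : ℝ => C * x ^ (-1 : ℝ)) atTop (nhds (C * 0)) :=
      (tendsto_rpow_neg_atTop one_pos).const_mul C
    rw [mul_zero] at h1
    refine (h1.comp hL).congr' ?_
    filter_upwards [hL.eventually_gt_atTop 0] with r hr
    simp only [Function.comp]
    rw [mul_assoc, ← rpow_add_one hr.ne']
    norm_num
  have hB := tendsto_radialBound_atTop hk hc
  have hlogB : ∀ᶠ r in nhdsWithin (0:ℝ) (Ioi 0), log (radialBound k c r) ≤ 2 * (-log r) := by
    filter_upwards [hL.eventually_ge_atTop 1, hmem,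
      hL.eventually_ge_atTop (log ((1 / c) ^ (1 / (k + 1 : ℝ))))] with r h1 h2 h3
    have hp : 0 < -log r := by linarith
    have hq : 0 < (1 / c) ^ (1 / (k + 1 : ℝ)) := by positivity
    rw [radialBound, log_mul hq.ne' (by positivity), log_rpow hp]
    have h4 : log (-log r) ≤ -log r := by linarith [log_le_sub_one_of_pos hp]
    have h5 : 0 ≤ log (-log r) := log_nonneg h1
    have h6 : (k : ℝ) / (k + 1) ≤ 1 := by rw [div_le_one (by positivity)]; linarith
    nlinarith
  have hzero : Tendsto (fun r => f r * log (radialBound k c r)) (nhdsWithin 0 (Ioi 0))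
      (nhds 0) := by
    have hup : Tendsto (fun r => 2 * (C * (-log r) ^ (-2 : ℝ) * (-log r)))
        (nhdsWithin 0 (Ioi 0)) (nhds 0) := by simpa using hlog.const_mul 2
    refine tendsto_of_tendsto_of_tendsto_of_le_of_le' tendsto_const_nhds hup ?_ ?_
    · filter_upwards [hmem, hB.eventually_ge_atTop 1] with r h1 h2
      exact mul_nonneg (hfpos r h1).le (log_nonneg h2)
    · filter_upwards [hmem, hB.eventually_ge_atTop 1, hfL, hlogB, hL.eventually_ge_atTop 1]
        with r h1 h2 h3 h4 h5
      have := mul_le_mul h3 h4 (log_nonneg h2) ((hfpos r h1).le.trans h3)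
      linarith
  have := (continuous_exp.tendsto 0).comp hzero
  rw [exp_zero] at this
  refine this.congr' ?_
  filter_upwards [hB.eventually_gt_atTop 0] with r hr
  simp only [Function.comp]
  rw [rpow_def_of_pos hr, mul_comm]

/-- Away from the origin the radial bound is harmless, whatever `f` does near `1`. -/
theorem exists_bound_radialBound_rpow {k : ℕ} (hk : 0 < k) {c : ℝ} (hc : 0 < c) {f : ℝ → ℝ}
    (hfc : ContinuousOn f (Ico 0 1)) (hfpos : ∀ r ∈ Ioo (0:ℝ) 1, 0 < f r) {q : ℝ} (hq : 0 < q)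
    {r₁ : ℝ} (hr₁ : 0 < r₁) :
    ∃ D : ℝ, ∀ r ∈ Ico r₁ 1, radialBound k c r ^ (q + f r) ≤ D := by
  obtain ⟨r₂, h2, hr₂⟩ : ∃ r₂ < (1:ℝ), ∀ r ∈ Ioo r₂ 1, radialBound k c r ≤ 1 := by
    have := (tendsto_radialBound_one hk (c := c)).eventually_le_const zero_lt_one
    obtain ⟨l, hl, hl'⟩ := (mem_nhdsLT_iff_exists_Ioo_subset).1 this
    exact ⟨l, hl, hl'⟩
  have hsub : Icc r₁ r₂ ⊆ Ioo 0 1 := fun x hx => ⟨hr₁.trans_le hx.1, hx.2.trans_lt h2⟩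
  have hcont : ContinuousOn (fun r => radialBound k c r ^ (q + f r)) (Icc r₁ r₂) := by
    refine ContinuousOn.rpow (continuousOn_radialBound.mono (hsub.trans Ioo_subset_Ioc_self))
      (continuousOn_const.add (hfc.mono (hsub.trans Ioo_subset_Ico_self))) fun r hr => Or.inr ?_
    linarith [hfpos r (hsub hr)]
  obtain ⟨D, hD⟩ := isCompact_Icc.exists_bound_of_continuousOn hcont
  refine ⟨max D 1, fun r hr => ?_⟩
  rcases le_or_gt r r₂ with h | h
  · exact ((le_abs_self _).trans (hD r ⟨hr.1, h⟩)).trans (le_max_left _ _)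
  · have hr' : r ∈ Ioo (0:ℝ) 1 := ⟨hr₁.trans_le hr.1, hr.2⟩
    refine le_trans ?_ (le_max_right _ _)
    exact rpow_le_one (radialBound_nonneg hc hr') (hr₂ r ⟨h, hr.2⟩) (by linarith [hfpos r hr'])

/-- Near the origin, an improved radial bound makes the exponential strictly subcritical. -/
theorem eventually_exponent_le {N k : ℕ} (hk : 0 < k) (hN : N = 2 * k) {f : ℝ → ℝ}
    (hfpos : ∀ r ∈ Ioo (0:ℝ) 1, 0 < f r)
    (hσ : ∃ σ : ℝ, 2 < σ ∧ IsBoundedUnder (· ≤ ·) (nhdsWithin (0:ℝ) (Ioi 0))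
      (fun r => f r * |log r| ^ σ)) {η : ℝ} (hη0 : 0 < η) (hη1 : η < 1) :
    ∃ θ < (1:ℝ), ∀ᶠ r in nhdsWithin (0:ℝ) (Ioi 0), ∀ x : ℝ,
      |x| ≤ η * radialBound k (cN N k) r →
      muN N k * |x| ^ (((N : ℝ) + 2) / N + f r) ≤ N * θ * (-log r) := by
  have hk' : (0:ℝ) < k := by exact_mod_cast hk
  have hN0 : (0:ℝ) < N := by exact_mod_cast (show 0 < N by omega)
  have hc : 0 < cN N k := cN_pos (by omega) (by omega)
  have hμ : 0 < muN N k := by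
    rw [muN_eq hk (by omega)]
    positivity
  set q : ℝ := ((N : ℝ) + 2) / N with hq
  have hq0 : 0 < q := by positivity
  have hηq : η ^ q < 1 := rpow_lt_one hη0.le hη1 hq0
  have hηq0 : 0 < η ^ q := by positivity
  obtain ⟨θ, hθ1, hθ2⟩ := exists_between hηq
  refine ⟨θ, hθ2, ?_⟩
  have hgt : 1 < θ / η ^ q := (one_lt_div hηq0).2 hθ1
  filter_upwards [(tendsto_radialBound_rpow_one hk hc hfpos hσ).eventually_le_const hgt,
    (tendsto_radialBound_atTop hk hc).eventually_gt_atTop 0,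
    Ioo_mem_nhdsGT (zero_lt_one (α := ℝ))] with r h1 h2 h3 x hx
  set B := radialBound k (cN N k) r with hB
  have hf := hfpos r h3
  have hL : 0 < -log r := by linarith [log_neg h3.1 h3.2]
  have e1 : (η * B) ^ (q + f r) ≤ η ^ q * (B ^ q * (θ / η ^ q)) := by
    rw [mul_rpow hη0.le h2.le, rpow_add h2]
    have : η ^ (q + f r) ≤ η ^ q := rpow_le_rpow_of_exponent_ge hη0 hη1.le (by linarith)
    gcongr
  calc muN N k * |x| ^ (q + f r) ≤ muN N k * (η * B) ^ (q + f r) := by gcongr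
    _ ≤ muN N k * (η ^ q * (B ^ q * (θ / η ^ q))) := by gcongr
    _ = θ * (muN N k * B ^ q) := by field_simp
    _ = N * θ * (-log r) := by rw [hB, hq, muN_mul_radialBound_rpow hk hN h3]; ring

theorem exists_pos_eventually_lt_of_liminf {u : ℕ → ℝ} (hu : ∀ j, 0 ≤ u j)
    (h : 0 < liminf u atTop) : ∃ δ > 0, ∀ᶠ j in atTop, δ < u j := by
  obtain ⟨δ, h0, h1⟩ := exists_between h
  exact ⟨δ, h0, eventually_lt_of_lt_liminf h1 (isBoundedUnder_of ⟨0, hu⟩)⟩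

/-- A nonconcentrating normalized sequence beats the radial bound by a fixed factor near `0`. -/
theorem exists_uniform_improvement {N k : ℕ} (hk : 0 < k) (hN : N = 2 * k) {r₀ δ : ℝ}
    (hr₀ : r₀ ∈ Ioo (0:ℝ) 1) (hδ : 0 < δ) :
    ∃ η : ℝ, 0 < η ∧ η < 1 ∧ ∀ᶠ r in nhdsWithin (0:ℝ) (Ioi 0), ∀ v v' : ℝ → ℝ,
      MemX1 N k v v' → normX1 N k v' = 1 →
      δ ≤ ∫ s in Ioo r₀ 1, s ^ (N - k) * |v' s| ^ (k + 1) →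
      |v r| ≤ η * radialBound k (cN N k) r := by
  have hk' : (0:ℝ) < k := by exact_mod_cast hk
  have hc : 0 < cN N k := cN_pos (by omega) (by omega)
  set c := cN N k with hcdef
  set p : ℝ := 1 / (k + 1 : ℝ) with hp
  have hp0 : 0 < p := by positivity
  set δ' := min δ (1 / c) with hδ'
  have hδ'0 : 0 < δ' := lt_min hδ (by positivity)
  have hδ'δ : δ' ≤ δ := min_le_left _ _
  have hδ'1 : δ' ≤ 1 / c := min_le_right _ _
  have hlt : (1 / c - δ') ^ p < (1 / c) ^ p :=
    rpow_lt_rpow (by linarith) (by linarith) hp0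
  have hcp : 0 < (1 / c) ^ p := by positivity
  set τ := (1 / c - δ') ^ p / (1 / c) ^ p with hτ
  have hτ1 : τ < 1 := (div_lt_one hcp).2 hlt
  have hτ0 : 0 ≤ τ := div_nonneg (rpow_nonneg (by linarith) _) hcp.le
  obtain ⟨η, h1, h2⟩ := exists_between hτ1
  refine ⟨η, hτ0.trans_lt h1, h2, ?_⟩
  filter_upwards [(tendsto_radialBound_atTop hk hc).eventually_ge_atTop
      (radialBound k c r₀ / (η - τ)), Ioo_mem_nhdsGT hr₀.1] with r h3 h4 v v' hv hn he
  have h5 := hv.abs_le_of_outer_energy hk hN hn hr₀ (hδ'δ.trans he) h4.1 h4.2.le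
  have h6 : (1 / c - δ') ^ p * (-log r) ^ ((k : ℝ) / (k + 1)) = τ * radialBound k c r := by
    rw [hτ, radialBound, ← hp]
    field_simp
  rw [← hcdef, ← hp, h6] at h5
  rw [div_le_iff₀ (by linarith)] at h3
  linarith

theorem lintegral_pow_pred_Ioo {N : ℕ} (hN : 0 < N) :
    ∫⁻ r in Ioo (0:ℝ) 1, ENNReal.ofReal (r ^ (N - 1)) = ENNReal.ofReal (1 / N) := by
  obtain ⟨n, rfl⟩ : ∃ n, N = n + 1 := ⟨N - 1, by omega⟩
  rw [Nat.add_sub_cancel, ← ofReal_integral_eq_lintegral_ofReal, ← integral_Ioc_eq_integral_Ioo,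
    ← intervalIntegral.integral_of_le zero_le_one, integral_pow]
  · simp
  · exact (continuous_pow n).integrableOn_Icc.mono_set Ioo_subset_Icc_self
  · exact (ae_restrict_iff' measurableSet_Ioo).2 (ae_of_all _ fun r hr => pow_nonneg hr.1.le _)

theorem lintegral_subcritical_majorant_ne_top {N : ℕ} (hN : 0 < N) {θ D : ℝ} (hθ : θ < 1) :
    ∫⁻ r in Ioo (0:ℝ) 1, ENNReal.ofReal (r ^ ((N : ℝ) - 1 - N * θ) + D) ≠ ⊤ := by
  have hN0 : (0:ℝ) < N := by exact_mod_cast hN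
  have h1 : IntervalIntegrable (fun r : ℝ => r ^ ((N : ℝ) - 1 - N * θ) + D) volume 0 1 := by
    refine (intervalIntegral.intervalIntegrable_rpow' ?_).add intervalIntegrable_const
    nlinarith
  have h2 : IntegrableOn (fun r : ℝ => r ^ ((N : ℝ) - 1 - N * θ) + D) (Ioo 0 1) :=
    h1.1.mono_set Ioo_subset_Ioc_self
  exact h2.lintegral_lt_top.ne

theorem tendsto_mtIntegral_of_subcritical {N : ℕ} (hN : 0 < N) {β θ D r₁ : ℝ} {f : ℝ → ℝ}
    {u : ℕ → ℝ → ℝ} (hβ : 0 ≤ β) (hfc : ContinuousOn f (Ico 0 1))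
    (hfpos : ∀ r ∈ Ioo (0:ℝ) 1, 0 < f r) (hu : ∀ j, ContinuousOn (u j) (Ioo 0 1))
    (hae : ∀ᵐ r ∂(volume.restrict (Ioo (0:ℝ) 1)), Tendsto (fun j => u j r) atTop (nhds 0))
    (hθ : θ < 1)
    (hnear : ∀ j, ∀ r ∈ Ioo 0 r₁,
      β * |u j r| ^ (((N : ℝ) + 2) / N + f r) ≤ N * θ * (-log r))
    (hfar : ∀ j, ∀ r ∈ Ico r₁ 1, |u j r| ^ (((N : ℝ) + 2) / N + f r) ≤ D) :
    Tendsto (fun j => mtIntegral N β f (u j)) atTop (nhds (ENNReal.ofReal (1 / N))) := by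
  rw [← lintegral_pow_pred_Ioo hN]
  have hN0 : (0:ℝ) < N := by exact_mod_cast hN
  have hexp : ∀ r ∈ Ioo (0:ℝ) 1, 0 < ((N : ℝ) + 2) / N + f r := fun r hr => by
    have := hfpos r hr
    positivity
  refine tendsto_lintegral_of_dominated_convergence'
    (fun r => ENNReal.ofReal (r ^ ((N : ℝ) - 1 - N * θ) + exp (β * D))) ?_ ?_
    (lintegral_subcritical_majorant_ne_top hN hθ) ?_
  · intro j
    refine AEMeasurable.ennreal_ofReal (ContinuousOn.aemeasurable ?_ measurableSet_Ioo)
    exact (continuous_pow _).continuousOn.mul (continuous_exp.comp_continuousOn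
      (continuousOn_const.mul ((hu j).abs.rpow (continuousOn_const.add
        (hfc.mono Ioo_subset_Ico_self)) fun r hr => Or.inr (hexp r hr))))
  · intro j
    refine (ae_restrict_iff' measurableSet_Ioo).2 (ae_of_all _ fun r hr => ?_)
    refine ENNReal.ofReal_le_ofReal ?_
    rcases lt_or_ge r r₁ with h | h
    · have e : r ^ ((N : ℝ) - 1 - N * θ) = r ^ (N - 1) * exp (N * θ * (-log r)) := by
        rw [rpow_sub hr.1, ← Nat.cast_pred hN, rpow_natCast, rpow_def_of_pos hr.1 (N * θ),
          div_eq_mul_inv, ← exp_neg]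
        congr 2
        ring
      have h1 : exp (β * |u j r| ^ (((N : ℝ) + 2) / N + f r)) ≤ exp (N * θ * (-log r)) :=
        exp_le_exp.2 (hnear j r ⟨hr.1, h⟩)
      have h2 := mul_le_mul_of_nonneg_left h1 (pow_nonneg hr.1.le (N - 1))
      rw [e]
      linarith [exp_pos (β * D)]
    · have h1 : exp (β * |u j r| ^ (((N : ℝ) + 2) / N + f r)) ≤ exp (β * D) :=
        exp_le_exp.2 (mul_le_mul_of_nonneg_left (hfar j r ⟨h, hr.2⟩) hβ)
      have h2 : r ^ (N - 1) ≤ 1 := pow_le_one₀ hr.1.le hr.2.le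
      have h3 := mul_le_mul h2 h1 (exp_pos _).le zero_le_one
      have h4 := rpow_nonneg hr.1.le ((N : ℝ) - 1 - N * θ)
      linarith
  · filter_upwards [hae, ae_restrict_mem measurableSet_Ioo] with r hr hr'
    have hp := hexp r hr'
    have h1 : Tendsto (fun j => |u j r| ^ (((N : ℝ) + 2) / N + f r)) atTop (nhds 0) := by
      have := hr.abs.rpow_const (p := ((N : ℝ) + 2) / N + f r) (Or.inr hp.le)
      rwa [abs_zero, zero_rpow hp.ne'] at this
    have h2 := (ENNReal.continuous_ofReal.tendsto _).comp
      (((continuous_exp.tendsto _).comp (h1.const_mul β)).const_mul (r ^ (N - 1)))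
    simpa [Function.comp_def] using h2

theorem stmt16 (N k : ℕ) (hk : 0 < k) (hN : N = 2 * k)
    (f : ℝ → ℝ) (hfc : ContinuousOn f (Ico 0 1)) (hf0 : f 0 = 0)
    (hfpos : ∀ r ∈ Ioo (0:ℝ) 1, 0 < f r) (hfnn : ∀ r ∈ Ico (0:ℝ) 1, 0 ≤ f r)
    (hσ : ∃ σ : ℝ, 2 < σ ∧ IsBoundedUnder (· ≤ ·) (nhdsWithin (0:ℝ) (Ioi 0))
      (fun r => f r * |log r| ^ σ))
    (vj vj' : ℕ → ℝ → ℝ)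
    (hmem : ∀ j, MemX1 N k (vj j) (vj' j)) (hnorm : ∀ j, normX1 N k (vj' j) = 1)
    (M : ℝ≥0∞)
    (hM : M = ⨆ p : {p : (ℝ → ℝ) × (ℝ → ℝ) // MemX1 N k p.1 p.2 ∧ normX1 N k p.2 = 1},
      mtIntegral N (muN N k) f p.1.1)
    (hmax : Tendsto (fun j => mtIntegral N (muN N k) f (vj j)) atTop (nhds M))
    (hweak : WeakConvX1 N k vj' (fun _ => 0))
    (hae : ∀ᵐ r ∂(volume.restrict (Ioo (0:ℝ) 1)), Tendsto (fun j => vj j r) atTop (nhds 0))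
    (hnotconc : ∃ r₀ ∈ Ioo (0:ℝ) 1,
      0 < liminf (fun j => ∫ r in Ioo r₀ 1, r ^ (N - k) * |vj' j r| ^ (k + 1)) atTop) :
    M = ENNReal.ofReal ((1 : ℝ) / N) := by
  have hN0 : 0 < N := by omega
  have hNr : (0:ℝ) < N := by exact_mod_cast hN0
  have hc : 0 < cN N k := cN_pos hN0 (by omega)
  have hμ : 0 ≤ muN N k := by
    rw [muN_eq hk hN0]
    positivity
  obtain ⟨r₀, hr₀, hlim⟩ := hnotconc
  obtain ⟨δ, hδ, hev⟩ := exists_pos_eventually_lt_of_liminf (fun j =>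
    setIntegral_nonneg measurableSet_Ioo fun r hr => by
      have := hr₀.1.trans hr.1
      positivity) hlim
  obtain ⟨η, hη0, hη1, himp⟩ := exists_uniform_improvement hk hN hr₀ hδ
  obtain ⟨θ, hθ, hexp⟩ := eventually_exponent_le hk hN hfpos hσ hη0 hη1
  obtain ⟨r₁, hr₁, hsub⟩ := (mem_nhdsGT_iff_exists_Ioo_subset).1 (himp.and hexp)
  obtain ⟨D, hD⟩ := exists_bound_radialBound_rpow hk hc hfc hfpos
    (q := ((N : ℝ) + 2) / N) (by positivity) hr₁
  obtain ⟨J, hJ⟩ := eventually_atTop.1 hev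
  have hshift : Tendsto (fun j => j + J) atTop atTop := tendsto_add_atTop_nat J
  refine tendsto_nhds_unique (hmax.comp hshift) (tendsto_mtIntegral_of_subcritical hN0 (r₁ := r₁)
    (D := D) (u := fun j => vj (j + J)) hμ hfc hfpos (fun j => (hmem _).continuousOn)
    (hae.mono fun r hr => hr.comp hshift) hθ ?_ ?_)
  · intro j r hr
    obtain ⟨h1, h2⟩ := hsub hr
    exact h2 _ (h1 _ _ (hmem _) (hnorm _) (hJ _ (Nat.le_add_left J j)).le)
  · intro j r hr
    have hr' : r ∈ Ioo (0:ℝ) 1 := ⟨lt_of_lt_of_le hr₁ hr.1, hr.2⟩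
    have := hfpos r hr'
    refine le_trans ?_ (hD r hr)
    exact rpow_le_rpow (abs_nonneg _) ((hmem _).abs_le_radialBound hk hN (hnorm _) hr')
      (by positivity)
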